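/- Let μ be a finite complex Borel measure on the unit circle 𝕋 such that all its Fourier coefficients with negative index vanish, i.e., ∫₀^{2π} e^{-ikθ} dμ(θ) = 0 for all integers k < 0. Then μ is absolutely continuous with respect to Lebesgue measure on 𝕋. -/

import Mathlib

open MeasureTheory Set
open scoped Real

/-- Integral of a (bounded measurable) function against a complex measure, via the
Jordan decompositions of its real and imaginary parts. -/
noncomputable def cmInt {α : Type*} [MeasurableSpace α]
    (μ : MeasureTheory.ComplexMeasure α) (f : α → ℂ) : ℂ :=
  ((∫ a, f a ∂μ.re.toJordanDecomposition.posPart)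
      - (∫ a, f a ∂μ.re.toJordanDecomposition.negPart))
    + Complex.I * ((∫ a, f a ∂μ.im.toJordanDecomposition.posPart)
      - (∫ a, f a ∂μ.im.toJordanDecomposition.negPart))

instance : Fact (0 < 2 * π) := ⟨by positivity⟩

namespace FMRiesz

open scoped ComplexConjugate ENNReal

abbrev Ci := AddCircle (2 * π)

lemma continuous_int (σ : Measure Ci) [IsFiniteMeasure σ] :
    Continuous fun f : C(Ci, ℂ) => ∫ x, f x ∂σ := by
  have h : (fun f : C(Ci, ℂ) => ∫ x, f x ∂σ)
      = fun f => ∫ x, (ContinuousMap.toLp 1 σ ℂ f : Ci → ℂ) x ∂σ := by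
    funext f
    exact integral_congr_ae (ContinuousMap.coeFn_toLp σ f).symm
  rw [h]
  exact continuous_integral.comp (ContinuousMap.toLp 1 σ ℂ).continuous

lemma meas_ext (σ τ : Measure Ci) [IsFiniteMeasure σ] [IsFiniteMeasure τ]
    (h : ∀ k : ℤ, ∫ x, fourier k x ∂σ = ∫ x, fourier k x ∂τ) : σ = τ := by
  have key : ∀ f : C(Ci, ℂ), ∫ x, f x ∂σ = ∫ x, f x ∂τ := by
    intro f
    have hf : f ∈ (Submodule.span ℂ (range <| @fourier (2 * π))).topologicalClosure := by
      rw [span_fourier_closure_eq_top]; trivial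
    have hc : IsClosed {f : C(Ci, ℂ) | ∫ x, f x ∂σ = ∫ x, f x ∂τ} :=
      isClosed_eq (continuous_int σ) (continuous_int τ)
    refine closure_minimal ?_ hc hf
    intro g hg
    have hi : ∀ (g : C(Ci, ℂ)) (ρ : Measure Ci) [IsFiniteMeasure ρ], Integrable (fun x => g x) ρ :=
      fun g ρ _ => g.continuous.integrable_of_hasCompactSupport (HasCompactSupport.of_compactSpace _)
    induction hg using Submodule.span_induction with
    | mem x hx => obtain ⟨k, rfl⟩ := hx; exact h k
    | zero => simp
    | add x y _ _ hx hy =>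
      simp only [mem_ofPred_eq, ContinuousMap.add_apply] at *
      rw [integral_add (hi x σ) (hi y σ), integral_add (hi x τ) (hi y τ), hx, hy]
    | smul a x _ hx =>
      simp only [mem_ofPred_eq, ContinuousMap.smul_apply] at *
      rw [integral_smul, integral_smul, hx]
  apply ext_of_forall_integral_eq_of_IsFiniteMeasure
  intro f
  have := key ⟨fun x => (f x : ℂ), by fun_prop⟩
  simp only [ContinuousMap.coe_mk, integral_complex_ofReal] at this
  exact_mod_cast this

lemma haar_fourier (k : ℤ) (hk : k ≠ 0) :
    ∫ x : Ci, fourier k x ∂AddCircle.haarAddCircle = 0 :=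
  integral_eq_zero_of_add_right_eq_neg (μ := AddCircle.haarAddCircle)
      (fourier_add_half_inv_index hk (by positivity))

lemma ac_of_fourier (σ : Measure Ci) [IsFiniteMeasure σ]
    (h : ∀ k : ℤ, 0 < k → ∫ x, fourier k x ∂σ = 0) (s : Set Ci) (hs : volume s = 0) : σ s = 0 := by
  have hs' : AddCircle.haarAddCircle s = 0 := by
    rw [AddCircle.volume_eq_smul_haarAddCircle] at hs
    simpa [Real.pi_pos.not_ge] using hs
  have : σ = (σ univ).toNNReal • (AddCircle.haarAddCircle : Measure Ci) := by
    apply meas_ext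
    intro k
    rw [integral_smul_nnreal_measure]
    rcases lt_trichotomy k 0 with hk | rfl | hk
    · rw [haar_fourier k hk.ne]
      have := h (-k) (by lia)
      simp only [fourier_neg, integral_conj] at this
      simpa using this
    · simp [measureReal_def, NNReal.smul_def, ENNReal.coe_toNNReal_eq_toReal]
    · rw [haar_fourier k hk.ne', h k hk]; simp
  rw [this]
  simp [hs']

lemma ae_zero (ν : Measure Ci) [IsFiniteMeasure ν] (u : Lp ℂ 2 ν)
    (h : ∀ k : ℤ, 0 < k → ∫ x, fourier k x * (conj (u x) * u x) ∂ν = 0)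
    (s : Set Ci) (hm : MeasurableSet s) (hs : volume s = 0) : ∀ᵐ x ∂ν, x ∈ s → u x = 0 := by
  have hu := Lp.memLp u
  have hmeas : AEMeasurable (fun x => ‖u x‖ₑ ^ 2) ν := by
    have := (Lp.aestronglyMeasurable u).enorm; fun_prop
  have hfin : ∫⁻ x, ‖u x‖ₑ ^ 2 ∂ν < ∞ := by
    have := lintegral_rpow_enorm_lt_top_of_eLpNorm_lt_top (by simp) (by simp) hu.2
    simpa using this
  have : IsFiniteMeasure (ν.withDensity fun x => ‖u x‖ₑ ^ 2) := isFiniteMeasure_withDensity hfin.ne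
  have h0 := ac_of_fourier (ν.withDensity fun x => ‖u x‖ₑ ^ 2) ?_ s hs
  · rw [withDensity_apply _ hm, lintegral_eq_zero_iff' hmeas.restrict] at h0
    have := (ae_restrict_iff' hm).1 h0
    filter_upwards [this] with x hx hxs
    simpa using hx hxs
  · intro k hk
    rw [integral_withDensity_eq_integral_toReal_smul₀ hmeas (by simp), ← h k hk]
    congr 1
    funext x
    rw [mul_comm (conj (u x)), Complex.mul_conj, Complex.normSq_eq_norm_sq]
    simp [mul_comm]

variable (ν : Measure Ci) [IsFiniteMeasure ν]

noncomputable def e (k : ℤ) : Lp ℂ 2 ν := ContinuousMap.toLp 2 ν ℂ (fourier k)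

noncomputable def H (n : ℤ) : Submodule ℂ (Lp ℂ 2 ν) :=
  (Submodule.span ℂ (Set.image (e ν) (Ici n))).topologicalClosure

lemma mem_H {n k : ℤ} (h : n ≤ k) : e ν k ∈ H ν n :=
  Submodule.le_topologicalClosure _ (Submodule.subset_span ⟨k, h, rfl⟩)

lemma H_le {n : ℤ} (S : Submodule ℂ (Lp ℂ 2 ν)) (hc : IsClosed (S : Set (Lp ℂ 2 ν)))
    (h : ∀ k, n ≤ k → e ν k ∈ S) : H ν n ≤ S := by
  refine Submodule.topologicalClosure_minimal _ (Submodule.span_le.2 ?_) hc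
  rintro _ ⟨k, hk, rfl⟩
  exact h k hk

lemma H_perp {n : ℤ} (w : Lp ℂ 2 ν) (h : ∀ k, n ≤ k → inner ℂ w (e ν k) = 0) :
    ∀ v ∈ H ν n, inner ℂ w v = 0 := by
  intro v hv
  have := H_le ν (ℂ ∙ w)ᗮ (Submodule.isClosed_orthogonal _) (n := n)
    (fun k hk => Submodule.mem_orthogonal_singleton_iff_inner_right.2 (h k hk))
  exact Submodule.mem_orthogonal_singleton_iff_inner_right.1 (this hv)

lemma dense_e (w : Lp ℂ 2 ν) (h : ∀ k, inner ℂ w (e ν k) = 0) : w = 0 := by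
  have htop : (Submodule.span ℂ (range (e ν))).topologicalClosure = ⊤ := by
    convert!
      (ContinuousMap.toLp_denseRange ℂ ν ℂ (p := 2) (by simp)).topologicalClosure_map_submodule
        span_fourier_closure_eq_top
    rw [Submodule.map_span]
    unfold e
    rw [range_comp']
    simp only [ContinuousLinearMap.coe_coe]
  have hle : (Submodule.span ℂ (range (e ν))).topologicalClosure ≤ (ℂ ∙ w)ᗮ := by
    refine Submodule.topologicalClosure_minimal _ (Submodule.span_le.2 ?_)
      (Submodule.isClosed_orthogonal _)
    rintro _ ⟨k, rfl⟩
    exact Submodule.mem_orthogonal_singleton_iff_inner_right.2 (h k)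
  rw [htop] at hle
  have := Submodule.mem_orthogonal_singleton_iff_inner_right.1 (hle (Submodule.mem_top (x := w)))
  simpa using this

/-- An element of `H n` orthogonal to `H (n+1)` vanishes on null sets. -/
lemma wandering {n : ℤ} (u : Lp ℂ 2 ν) (hu : u ∈ H ν n)
    (hp : ∀ k, n + 1 ≤ k → inner ℂ u (e ν k) = 0)
    (s : Set Ci) (hm : MeasurableSet s) (hs : volume s = 0) : ∀ᵐ x ∂ν, x ∈ s → u x = 0 := by
  apply ae_zero ν u _ s hm hs
  intro k hk
  have hw : MemLp (fun x => fourier (-k) x * u x) 2 ν := by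
    refine (Lp.memLp u).of_le ((fourier (-k)).continuous.aestronglyMeasurable.mul
      (Lp.aestronglyMeasurable u)) ?_
    refine Filter.Eventually.of_forall fun x => ?_
    rw [norm_mul, fourier_apply, Circle.norm_coe, one_mul]
  have hin : ∀ v : Lp ℂ 2 ν, inner ℂ hw.toLp v = ∫ x, fourier k x * (conj (u x) * v x) ∂ν := by
    intro v
    rw [L2.inner_def]
    apply integral_congr_ae
    filter_upwards [hw.coeFn_toLp] with x hx
    rw [hx, RCLike.inner_apply, map_mul, fourier_neg, Complex.conj_conj]
    ring
  rw [← hin u]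
  apply H_perp ν _ _ u hu
  intro j hj
  rw [hin, ← hp (j + k) (by lia), L2.inner_def]
  apply integral_congr_ae
  filter_upwards [ContinuousMap.coeFn_toLp (p := 2) (𝕜 := ℂ) ν (fourier j),
    ContinuousMap.coeFn_toLp (p := 2) (𝕜 := ℂ) ν (fourier (j + k))] with x hx hx'
  unfold e
  rw [hx, hx', RCLike.inner_apply, fourier_add]
  ring

instance (n : ℤ) : CompleteSpace (H ν n) :=
  (Submodule.isClosed_topologicalClosure _).completeSpace_coe

lemma H_mono {n m : ℤ} (h : n ≤ m) : H ν m ≤ H ν n :=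
  H_le ν _ (Submodule.isClosed_topologicalClosure _) fun _ hk => mem_H ν (h.trans hk)

lemma indicator_mem (s : Set Ci) (hm : MeasurableSet s) (hs : volume s = 0) (n : ℤ) :
    indicatorConstLp 2 hm (measure_ne_top ν s) (1 : ℂ) ∈ H ν n := by
  set χ := indicatorConstLp 2 hm (measure_ne_top ν s) (1 : ℂ) with hχ
  have step : ∀ n, (H ν n).starProjection χ = (H ν (n + 1)).starProjection χ := by
    intro n
    set a := (H ν n).starProjection χ with ha
    set b := (H ν (n + 1)).starProjection χ with hb
    have ham : a ∈ H ν n := Submodule.starProjection_apply_mem _ _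
    have hbm' : b ∈ H ν (n + 1) := Submodule.starProjection_apply_mem _ _
    have hbm : b ∈ H ν n := H_mono ν (by lia) hbm'
    have hum : a - b ∈ H ν n := Submodule.sub_mem _ ham hbm
    have h1 : ∀ v ∈ H ν n, inner ℂ (χ - a) v = 0 := fun v hv =>
      Submodule.starProjection_inner_eq_zero _ _ hv
    have h2 : ∀ v ∈ H ν (n + 1), inner ℂ (χ - b) v = 0 := fun v hv =>
      Submodule.starProjection_inner_eq_zero _ _ hv
    have h3 : ∀ v ∈ H ν (n + 1), inner ℂ (a - b) v = 0 := by
      intro v hv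
      have : a - b = (χ - b) - (χ - a) := by abel
      rw [this, inner_sub_left, h2 v hv, h1 v (H_mono ν (by lia) hv), sub_zero]
    have hz := wandering ν (a - b) hum (fun k hk => h3 _ (mem_H ν hk)) s hm hs
    have h4 : inner ℂ χ (a - b) = 0 := by
      rw [hχ, L2.inner_indicatorConstLp_one]
      rw [setIntegral_congr_ae (g := fun _ => 0) hm hz]
      simp
    have h5 : inner ℂ (a - b) (a - b) = 0 := by
      have : a - b = χ - (χ - a) - b := by abel
      nth_rewrite 1 [this]
      rw [inner_sub_left, inner_sub_left, h4, h1 _ hum, ← inner_conj_symm, h3 _ hbm']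
      simp
    exact sub_eq_zero.1 (inner_self_eq_zero.1 h5)
  have all : ∀ m : ℤ, (H ν m).starProjection χ = (H ν n).starProjection χ := by
    intro m
    induction m using Int.inductionOn' (b := n) with
    | zero => rfl
    | succ k _ ih => rw [← step, ih]
    | pred k _ ih => rw [step (k - 1), sub_add_cancel, ih]
  have : χ - (H ν n).starProjection χ = 0 := by
    apply dense_e
    intro k
    rw [← all k]
    exact Submodule.starProjection_inner_eq_zero _ _ (mem_H ν le_rfl)
  rw [← Submodule.starProjection_eq_self_iff]
  exact (sub_eq_zero.1 this).symm

variable {ν} in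
lemma integrable_part {p : Measure Ci} (hp : p ≤ ν) (f : Lp ℂ 2 ν) : Integrable f p :=
  ((Lp.memLp f).integrable (by norm_num)).mono_measure hp

variable {ν} in
lemma continuous_part {p : Measure Ci} (hp : p ≤ ν) :
    Continuous fun f : Lp ℂ 2 ν => ∫ x, f x ∂p := by
  have : IsFiniteMeasure p := isFiniteMeasure_of_le ν hp
  let L : Lp ℂ 2 ν →ₗ[ℂ] ℂ :=
    { toFun := fun f => ∫ x, f x ∂p
      map_add' := fun f g => by
        rw [← integral_add (integrable_part hp f) (integrable_part hp g)]
        exact integral_congr_ae (Measure.absolutelyContinuous_of_le hp (Lp.coeFn_add f g))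
      map_smul' := fun c f => by
        rw [RingHom.id_apply, ← integral_smul]
        exact integral_congr_ae (Measure.absolutelyContinuous_of_le hp (Lp.coeFn_smul c f)) }
  let C : ℝ≥0∞ := ν univ ^ (1 / (1 : ℝ≥0∞).toReal - 1 / (2 : ℝ≥0∞).toReal)
  have hC : C ≠ ∞ := ENNReal.rpow_ne_top_of_nonneg (by norm_num) (measure_ne_top _ _)
  refine (L.mkContinuous C.toReal ?_).continuous
  intro f
  change ‖∫ x, f x ∂p‖ ≤ C.toReal * ‖f‖
  have h1 : ‖∫ x, f x ∂p‖ₑ ≤ eLpNorm f 2 ν * C :=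
    (enorm_integral_le_lintegral_enorm _).trans <|
      (lintegral_mono' hp le_rfl).trans <| by
        rw [← eLpNorm_one_eq_lintegral_enorm]
        exact eLpNorm_le_eLpNorm_mul_rpow_measure_univ (by norm_num) (Lp.aestronglyMeasurable f)
  have h2 := ENNReal.toReal_mono (ENNReal.mul_ne_top (Lp.memLp f).2.ne hC) h1
  rw [ENNReal.toReal_mul, toReal_enorm] at h2
  rw [Lp.norm_def]
  linarith

end FMRiesz

open FMRiesz in
/-- The F. and M. Riesz theorem: a finite complex Borel measure on the circle all of whose
Fourier coefficients of negative index vanish is absolutely continuous with respect to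
Lebesgue (Haar) measure on the circle. -/
theorem stmt0 (μ : MeasureTheory.ComplexMeasure (AddCircle (2 * π)))
    (h : ∀ k : ℤ, k < 0 → cmInt μ (fun θ => fourier (-k) θ) = 0) :
    ∀ s : Set (AddCircle (2 * π)), MeasurableSet s → volume s = 0 → μ s = 0 := by
  intro s hm hs
  set p1 := μ.re.toJordanDecomposition.posPart with hp1
  set p2 := μ.re.toJordanDecomposition.negPart with hp2
  set p3 := μ.im.toJordanDecomposition.posPart with hp3
  set p4 := μ.im.toJordanDecomposition.negPart with hp4
  let ν : Measure Ci := p1 + p2 + (p3 + p4)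
  have l1 : p1 ≤ ν := (Measure.le_add_right le_rfl).trans (Measure.le_add_right le_rfl)
  have l2 : p2 ≤ ν := (Measure.le_add_left le_rfl).trans (Measure.le_add_right le_rfl)
  have l3 : p3 ≤ ν := (Measure.le_add_right le_rfl).trans (Measure.le_add_left le_rfl)
  have l4 : p4 ≤ ν := (Measure.le_add_left le_rfl).trans (Measure.le_add_left le_rfl)
  have hfin : IsFiniteMeasure ν := by infer_instance
  have cm : ∀ f, cmInt μ f = ((∫ a, f a ∂p1) - (∫ a, f a ∂p2))
    + Complex.I * ((∫ a, f a ∂p3) - (∫ a, f a ∂p4)) := fun f => rfl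
  have cm_congr : ∀ f g : Ci → ℂ, f =ᵐ[ν] g → cmInt μ f = cmInt μ g := by
    intro f g hfg
    rw [cm, cm, integral_congr_ae (Measure.absolutelyContinuous_of_le l1 hfg),
      integral_congr_ae (Measure.absolutelyContinuous_of_le l2 hfg),
      integral_congr_ae (Measure.absolutelyContinuous_of_le l3 hfg),
      integral_congr_ae (Measure.absolutelyContinuous_of_le l4 hfg)]
  let S : Submodule ℂ (Lp ℂ 2 ν) :=
    { carrier := {f | cmInt μ f = 0}
      zero_mem' := by
        change cmInt μ _ = 0
        rw [cm_congr _ _ (Lp.coeFn_zero ℂ 2 ν), cm]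
        simp
      add_mem' := by
        intro f g hf hg
        change cmInt μ _ = 0 at *
        rw [cm_congr _ _ (Lp.coeFn_add f g)]
        rw [cm] at *
        simp only [Pi.add_apply]
        rw [integral_add (integrable_part l1 f) (integrable_part l1 g),
          integral_add (integrable_part l2 f) (integrable_part l2 g),
          integral_add (integrable_part l3 f) (integrable_part l3 g),
          integral_add (integrable_part l4 f) (integrable_part l4 g)]
        linear_combination hf + hg
      smul_mem' := by
        intro c f hf
        change cmInt μ _ = 0 at *
        rw [cm_congr _ _ (Lp.coeFn_smul c f)]
        rw [cm] at *
        simp only [Pi.smul_apply]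
        rw [integral_smul, integral_smul, integral_smul, integral_smul]
        simp only [smul_eq_mul]
        linear_combination c * hf }
  have hc : IsClosed (S : Set (Lp ℂ 2 ν)) := by
    change IsClosed {f : Lp ℂ 2 ν | cmInt μ f = 0}
    simp only [cm]
    exact isClosed_eq (((continuous_part l1).sub (continuous_part l2)).add
      (continuous_const.mul ((continuous_part l3).sub (continuous_part l4)))) continuous_const
  have hle : H ν 1 ≤ S := by
    apply H_le ν S hc
    intro k hk
    change cmInt μ _ = 0
    have := h (-k) (by lia)
    rw [neg_neg] at this
    rw [← this]
    exact cm_congr _ _ (ContinuousMap.coeFn_toLp ν (fourier k))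
  have hχ : cmInt μ (indicatorConstLp 2 hm (measure_ne_top ν s) (1 : ℂ)) = 0 :=
    hle (indicator_mem ν s hm hs 1)
  rw [cm_congr _ _ indicatorConstLp_coeFn, cm] at hχ
  simp only [integral_indicator_const _ hm] at hχ
  have hre : μ.re s = p1.real s - p2.real s := by
    conv_lhs => rw [← SignedMeasure.toSignedMeasure_toJordanDecomposition μ.re]
    rw [JordanDecomposition.toSignedMeasure, Measure.toSignedMeasure_sub_apply hm]
  have him : μ.im s = p3.real s - p4.real s := by
    conv_lhs => rw [← SignedMeasure.toSignedMeasure_toJordanDecomposition μ.im]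
    rw [JordanDecomposition.toSignedMeasure, Measure.toSignedMeasure_sub_apply hm]
  have hr := congrArg Complex.re hχ
  have hi := congrArg Complex.im hχ
  simp at hr hi
  apply Complex.ext
  · change μ.re s = 0
    linarith
  · change μ.im s = 0
    linarith
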